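/- arXiv:2207.08853 — 2 statements merged into one kernel-verified Lean document; each statement's English description precedes it below -/
import Mathlib

section
/- For all positive integers n, m and all r ≤ min{n, m}, there exists an open and dense subset 𝒜_r of M_r = { A ∈ ℝ^{n×m} : rank A = r } (with the subspace topology from ℝ^{n×m}) such that for every A ∈ 𝒜_r and every positive integer d, the rank of the d-th Hadamard power equals rank(A^∘d) = min{ binom(r + d − 1, d), n, m }. -/
open Topology

/-- The `d`-th Hadamard power of a product with inner dimension `r` factors through the space of
degree `d` monomials in `r` variables. -/
theorem map_pow_mul_eq {n m : Type*} {r : ℕ} (X : Matrix n (Fin r) ℝ) (Y : Matrix (Fin r) m ℝ)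
    (d : ℕ) :
    (X * Y).map (· ^ d) =
      (Matrix.of fun i (s : Sym (Fin r) d) => (s.1.map (X i)).prod) *
        (Matrix.of fun (s : Sym (Fin r) d) j =>
          (s.1.countPerms : ℝ) * (s.1.map fun a => Y a j).prod) := by
  ext i j
  simp only [Matrix.map_apply, Matrix.mul_apply, Matrix.of_apply]
  rw [Finset.sum_pow, Finset.sym_univ]
  refine Finset.sum_congr rfl fun s _ => ?_
  rw [Multiset.prod_map_mul]
  ring

/-- Rank factorization, with one-sided inverses of the factors. -/
theorem exists_rank_factorization {n m : ℕ} (A : Matrix (Fin n) (Fin m) ℝ) {r : ℕ}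
    (hA : A.rank = r) :
    ∃ (X : Matrix (Fin n) (Fin r) ℝ) (Y : Matrix (Fin r) (Fin m) ℝ)
      (L : Matrix (Fin r) (Fin n) ℝ) (R : Matrix (Fin m) (Fin r) ℝ),
      A = X * Y ∧ L * X = 1 ∧ Y * R = 1 := by
  let f := Matrix.toLin' A
  have hf : Module.finrank ℝ (LinearMap.range f) = r := hA
  let e : LinearMap.range f ≃ₗ[ℝ] (Fin r → ℝ) :=
    LinearEquiv.ofFinrankEq _ _ (by simpa using hf)
  let g : (Fin m → ℝ) →ₗ[ℝ] (Fin r → ℝ) := e.toLinearMap ∘ₗ f.rangeRestrict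
  let h : (Fin r → ℝ) →ₗ[ℝ] (Fin n → ℝ) := (LinearMap.range f).subtype ∘ₗ e.symm.toLinearMap
  have hg : LinearMap.range g = ⊤ :=
    LinearMap.range_eq_top.2 (e.surjective.comp f.surjective_rangeRestrict)
  have hh : LinearMap.ker h = ⊥ :=
    LinearMap.ker_eq_bot.2 (Subtype.val_injective.comp e.symm.injective)
  obtain ⟨g', hg'⟩ := g.exists_rightInverse_of_surjective hg
  obtain ⟨h', hh'⟩ := h.exists_leftInverse_of_injective hh
  refine ⟨LinearMap.toMatrix' h, LinearMap.toMatrix' g, LinearMap.toMatrix' h',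
    LinearMap.toMatrix' g', ?_, ?_, ?_⟩
  · rw [← LinearMap.toMatrix'_comp]
    have : h ∘ₗ g = f := by
      refine LinearMap.ext fun v => ?_
      simp [h, g]
    rw [this, LinearMap.toMatrix'_toLin']
  · rw [← LinearMap.toMatrix'_comp, hh', LinearMap.toMatrix'_id]
  · rw [← LinearMap.toMatrix'_comp, hg', LinearMap.toMatrix'_id]

theorem rank_map_pow_le {n m r d : ℕ} (A : Matrix (Fin n) (Fin m) ℝ) (hA : A.rank = r) :
    (A.map (· ^ d)).rank ≤ (r + d - 1).choose d := by
  obtain ⟨X, Y, -, -, rfl, -, -⟩ := exists_rank_factorization A hA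
  rw [map_pow_mul_eq]
  refine (Matrix.rank_mul_le_left _ _).trans ((Matrix.rank_le_card_width _).trans_eq ?_)
  simp [Sym.card_sym_eq_choose]

theorem le_rank_of_det_submatrix_ne_zero {n m k : ℕ} {A : Matrix (Fin n) (Fin m) ℝ}
    (f : Fin k → Fin n) (g : Fin k → Fin m) (h : (A.submatrix f g).det ≠ 0) : k ≤ A.rank := by
  simpa [Matrix.rank_of_det_ne_zero h] using A.rank_submatrix_le f g

theorem det_pow_gram_ne_zero {k r d : ℕ} (hk : k ≤ (r + d - 1).choose d) :
    (Matrix.of fun i j : Fin k =>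
      (∑ a : Fin r, ((Nat.nth Nat.Prime a : ℕ) : ℝ) ^ (i : ℕ) *
        ((Nat.nth Nat.Prime a : ℕ) : ℝ) ^ (j : ℕ)) ^ d).det ≠ 0 := by
  let c : Sym (Fin r) d → ℕ := fun s => (s.1.map fun a : Fin r => Nat.nth Nat.Prime a).prod
  have hc : Function.Injective c := by
    intro s t hst
    have key : ∀ s : Sym (Fin r) d, UniqueFactorizationMonoid.normalizedFactors (c s) =
        s.1.map fun a : Fin r => Nat.nth Nat.Prime a := fun s =>
      UniqueFactorizationMonoid.normalizedFactors_prod_of_prime fun p hp => by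
        obtain ⟨a, -, rfl⟩ := Multiset.mem_map.1 hp
        exact (Nat.prime_nth_prime a).prime
    refine Subtype.ext (Multiset.map_injective (f := fun a : Fin r => Nat.nth Nat.Prime a) ?_ ?_)
    · exact (Nat.nth_injective Nat.infinite_setOfPred_prime).comp Fin.val_injective
    · exact (key s).symm.trans ((congrArg _ hst).trans (key t))
  have hcard : Fintype.card (Fin k) ≤ Fintype.card (Sym (Fin r) d) := by
    simpa [Sym.card_sym_eq_choose] using hk
  obtain ⟨ι⟩ := Function.Embedding.nonempty_of_card_le hcard
  rw [Ne, ← Matrix.exists_mulVec_eq_zero_iff]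
  rintro ⟨v, hv, hv0⟩
  apply hv
  have hpow : ∀ (s : Sym (Fin r) d) (i : ℕ),
      (s.1.map fun a : Fin r => ((Nat.nth Nat.Prime a : ℕ) : ℝ) ^ i).prod = (c s : ℝ) ^ i := by
    intro s i
    simp [c, Multiset.prod_map_pow, Nat.cast_multiset_prod]
  have hentry : ∀ i j : Fin k, (∑ a : Fin r, ((Nat.nth Nat.Prime a : ℕ) : ℝ) ^ (i : ℕ) *
        ((Nat.nth Nat.Prime a : ℕ) : ℝ) ^ (j : ℕ)) ^ d =
      ∑ s : Sym (Fin r) d, (s.1.countPerms : ℝ) * ((c s : ℝ) ^ (i : ℕ) * (c s : ℝ) ^ (j : ℕ)) := by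
    intro i j
    rw [Finset.sum_pow, Finset.sym_univ]
    refine Finset.sum_congr rfl fun s _ => ?_
    rw [Multiset.prod_map_mul, hpow, hpow]
  have hquad : ∑ s : Sym (Fin r) d, (s.1.countPerms : ℝ) *
      (∑ i : Fin k, v i * (c s : ℝ) ^ (i : ℕ)) ^ 2 = 0 := by
    have h1 : ∑ i : Fin k, v i * (∑ j : Fin k, (∑ a : Fin r, ((Nat.nth Nat.Prime a : ℕ) : ℝ) ^ (i : ℕ) *
        ((Nat.nth Nat.Prime a : ℕ) : ℝ) ^ (j : ℕ)) ^ d * v j) = 0 := by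
      refine Finset.sum_eq_zero fun i _ => ?_
      have := congrFun hv0 i
      simp only [Matrix.mulVec, dotProduct, Matrix.of_apply, Pi.zero_apply] at this
      rw [this, mul_zero]
    rw [← h1]
    simp_rw [hentry, sq, Finset.sum_mul_sum, Finset.mul_sum, Finset.sum_mul, Finset.mul_sum]
    rw [Finset.sum_comm]
    refine Finset.sum_congr rfl fun i _ => ?_
    rw [Finset.sum_comm]
    refine Finset.sum_congr rfl fun j _ => Finset.sum_congr rfl fun s _ => ?_
    ring
  rw [Finset.sum_eq_zero_iff_of_nonneg fun s _ => by positivity] at hquad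
  refine Matrix.eq_zero_of_forall_index_sum_mul_pow_eq_zero (f := fun j => (c (ι j) : ℝ))
    (Nat.cast_injective.comp (hc.comp ι.injective)) fun j => ?_
  have hpos : ((ι j).1.countPerms : ℝ) ≠ 0 := by
    have : 0 < (ι j).1.countPerms := Nat.multinomial_pos _ _
    positivity
  exact pow_eq_zero_iff two_ne_zero |>.1
    ((mul_eq_zero.1 (hquad (ι j) (Finset.mem_univ _))).resolve_left hpos)

/-- A polynomial in the entries that is nonzero at some product `X * Y` of inner dimension `r` is
nonzero on a dense set of matrices of rank `r`. -/
theorem dense_eval_ne_zero {n m r : ℕ} (p : MvPolynomial (Fin n × Fin m) ℝ)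
    (X₁ : Matrix (Fin n) (Fin r) ℝ) (Y₁ : Matrix (Fin r) (Fin m) ℝ)
    (hp : MvPolynomial.eval (fun x => (X₁ * Y₁) x.1 x.2) p ≠ 0) :
    Dense {A : {A : Matrix (Fin n) (Fin m) ℝ // A.rank = r} |
      MvPolynomial.eval (fun x => A.1 x.1 x.2) p ≠ 0} := by
  intro A
  obtain ⟨X, Y, L, R, hA, hL, hR⟩ := exists_rank_factorization A.1 A.2
  let Z : ℝ → Matrix (Fin n) (Fin m) ℝ := fun t => (X + t • (X₁ - X)) * (Y + t • (Y₁ - Y))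
  have hZ : Continuous Z := by fun_prop
  have hZ0 : Z 0 = A.1 := by simp [Z, hA]
  let q : Polynomial ℝ := MvPolynomial.aeval (fun x : Fin n × Fin m =>
    ∑ a, (Polynomial.C (X x.1 a) + Polynomial.X * Polynomial.C (X₁ x.1 a - X x.1 a)) *
      (Polynomial.C (Y a x.2) + Polynomial.X * Polynomial.C (Y₁ a x.2 - Y a x.2))) p
  have hq : ∀ t, q.eval t = MvPolynomial.eval (fun x => Z t x.1 x.2) p := by
    intro t
    rw [← Polynomial.coe_aeval_eq_eval, MvPolynomial.comp_aeval_apply]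
    refine (congrArg (fun f => MvPolynomial.aeval f p) (funext fun x => ?_)).trans
      (DFunLike.congr_fun (MvPolynomial.coe_aeval_eq_eval _) p)
    simp [Z, Matrix.mul_apply]
  have hq0 : q ≠ 0 := by
    rintro h
    apply hp
    have := hq 1
    simpa [h, Z] using this.symm
  have hne : ∀ᶠ t in 𝓝[≠] (0 : ℝ), q.eval t ≠ 0 :=
    nhdsNE_le_cofinite 0 (Polynomial.finite_setOfPred_isRoot hq0).compl_mem_cofinite
  have hdet : ∀ᶠ t in 𝓝[≠] (0 : ℝ), (L * Z t * R).det ≠ 0 := by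
    have hcont : Continuous fun t => (L * Z t * R).det := by fun_prop
    refine (hcont.continuousAt.eventually_ne ?_).filter_mono nhdsWithin_le_nhds
    rw [hZ0, hA, ← Matrix.mul_assoc, hL, Matrix.one_mul, hR]
    simp
  rw [mem_closure_iff_nhds]
  intro U hU
  obtain ⟨V, hV, hVU⟩ := mem_nhds_subtype _ _ _ |>.1 hU
  have hZV : ∀ᶠ t in 𝓝[≠] (0 : ℝ), Z t ∈ V :=
    (hZ.continuousAt.eventually_mem (by rwa [hZ0])).filter_mono nhdsWithin_le_nhds
  obtain ⟨t, h1, h2, h3⟩ := (hne.and (hdet.and hZV)).exists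
  have hrank : (Z t).rank = r := by
    apply le_antisymm
    · exact (Matrix.rank_mul_le_left _ _).trans (Matrix.rank_le_width _)
    · calc r = (L * Z t * R).rank := by simp [Matrix.rank_of_det_ne_zero h2]
        _ ≤ (L * Z t).rank := Matrix.rank_mul_le_left _ _
        _ ≤ (Z t).rank := Matrix.rank_mul_le_right _ _
  exact ⟨⟨Z t, hrank⟩, hVU h3, by rwa [Set.mem_ofPred_eq, ← hq]⟩

theorem isOpen_eval_ne_zero {n m r : ℕ} (p : MvPolynomial (Fin n × Fin m) ℝ) :
    IsOpen {A : {A : Matrix (Fin n) (Fin m) ℝ // A.rank = r} |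
      MvPolynomial.eval (fun x => A.1 x.1 x.2) p ≠ 0} := by
  refine isOpen_ne_fun (p.continuous_eval.comp ?_) continuous_const
  exact continuous_pi fun x => continuous_subtype_val.matrix_elem x.1 x.2

/-- If the terms of the Leibniz expansion have distinct absolute values, one term dominates in all
large Hadamard powers, uniformly near the given matrix. -/
theorem eventually_det_map_pow_ne_zero {k : ℕ} (B₀ : Matrix (Fin k) (Fin k) ℝ)
    (h₀ : ∏ i, B₀ i i ≠ 0)
    (h : ∀ σ τ : Equiv.Perm (Fin k), σ ≠ τ → (∏ i, B₀ (σ i) i) ^ 2 ≠ (∏ i, B₀ (τ i) i) ^ 2) :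
    ∃ D : ℕ, ∀ᶠ B in 𝓝 B₀, ∀ d ≥ D, (B.map (· ^ d)).det ≠ 0 := by
  let P : Equiv.Perm (Fin k) → Matrix (Fin k) (Fin k) ℝ → ℝ := fun σ B => |∏ i, B (σ i) i|
  have hP : ∀ σ, Continuous (P σ) := fun σ => by fun_prop
  obtain ⟨σ₀, hσ₀⟩ := Finite.exists_max fun σ => P σ B₀
  have hlt : ∀ σ, σ ≠ σ₀ → P σ B₀ < P σ₀ B₀ := fun σ hσ =>
    (hσ₀ σ).lt_of_ne fun he => h σ σ₀ hσ ((sq_eq_sq_iff_abs_eq_abs _ _).2 he)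
  have hpos : 0 < P σ₀ B₀ := (abs_pos.2 h₀).trans_le (hσ₀ 1)
  have hq : ∀ᶠ q in 𝓝[<] (1 : ℝ), ∀ σ, σ ≠ σ₀ → P σ B₀ < q * P σ₀ B₀ := by
    refine Filter.eventually_all.2 fun σ => ?_
    by_cases hσ : σ = σ₀
    · simp [hσ]
    have hc : ContinuousAt (fun q : ℝ => q * P σ₀ B₀) 1 := by fun_prop
    filter_upwards [(hc.eventually_const_lt (by simpa using hlt σ hσ)).filter_mono
      nhdsWithin_le_nhds] with q hq _ using hq
  have hq0 : ∀ᶠ q in 𝓝[<] (1 : ℝ), 0 < q :=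
    (eventually_gt_nhds one_pos).filter_mono nhdsWithin_le_nhds
  obtain ⟨q, hq, hq0, hq1⟩ := (hq.and (hq0.and self_mem_nhdsWithin)).exists
  have hlim : Filter.Tendsto (fun d : ℕ => (Fintype.card (Equiv.Perm (Fin k)) : ℝ) * q ^ d)
      Filter.atTop (𝓝 0) := by
    simpa using (tendsto_pow_atTop_nhds_zero_of_lt_one hq0.le hq1).const_mul
      (Fintype.card (Equiv.Perm (Fin k)) : ℝ)
  obtain ⟨D, hD⟩ := Filter.eventually_atTop.1 (hlim.eventually_lt_const one_pos)
  refine ⟨D, ?_⟩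
  have hnear : ∀ᶠ B in 𝓝 B₀, ∀ σ, σ ≠ σ₀ → P σ B < q * P σ₀ B := by
    refine Filter.eventually_all.2 fun σ => ?_
    by_cases hσ : σ = σ₀
    · simp [hσ]
    filter_upwards [(hP σ).continuousAt.eventually_lt (((hP σ₀).const_mul q).continuousAt)
      (hq σ hσ)] with B hB _ using hB
  filter_upwards [hnear, (hP σ₀).continuousAt.eventually_const_lt hpos] with B hB hB0 d hd hdet
  have hterm : ∀ σ : Equiv.Perm (Fin k),
      |Equiv.Perm.sign σ • ∏ i, (B.map (· ^ d)) (σ i) i| = P σ B ^ d := by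
    intro σ
    have : |((Equiv.Perm.sign σ : ℤ) : ℝ)| = 1 := by
      rcases Int.units_eq_one_or (Equiv.Perm.sign σ) with h | h <;> simp [h]
    simp [P, Units.smul_def, abs_mul, this, Finset.prod_pow, abs_pow]
  rw [Matrix.det_apply, ← Finset.add_sum_erase _ _ (Finset.mem_univ σ₀)] at hdet
  have h1 := hterm σ₀
  rw [eq_neg_of_add_eq_zero_left hdet, abs_neg] at h1
  have h2 : P σ₀ B ^ d ≤ Fintype.card (Equiv.Perm (Fin k)) * q ^ d * P σ₀ B ^ d := by
    rw [← h1]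
    refine (Finset.abs_sum_le_sum_abs _ _).trans ?_
    rw [h1]
    calc _ ≤ ∑ σ ∈ Finset.univ.erase σ₀, (q * P σ₀ B) ^ d := by
          refine Finset.sum_le_sum fun σ hσ => ?_
          rw [hterm]
          exact pow_le_pow_left₀ (abs_nonneg _) (hB σ (Finset.ne_of_mem_erase hσ)).le _
      _ ≤ ∑ σ : Equiv.Perm (Fin k), (q * P σ₀ B) ^ d :=
          Finset.sum_le_sum_of_subset_of_nonneg (Finset.erase_subset _ _)
            fun σ _ _ => by positivity
      _ = _ := by simp [mul_pow, mul_assoc]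
  have h3 : 0 < P σ₀ B ^ d := by positivity
  nlinarith [hD d hd]

theorem dense_iInter_of_isOpen_finite {ι X : Type*} [Finite ι] [TopologicalSpace X]
    {f : ι → Set X} (ho : ∀ i, IsOpen (f i)) (hd : ∀ i, Dense (f i)) : Dense (⋂ i, f i) :=
  (Set.finite_range f).dense_sInter (Set.forall_mem_range.2 ho) (Set.forall_mem_range.2 hd)

theorem exists_mul_eq_one_add {n m r : ℕ} (hr : 2 ≤ r) (s : Fin n → ℝ) (t : Fin m → ℝ) :
    ∃ (X : Matrix (Fin n) (Fin r) ℝ) (Y : Matrix (Fin r) (Fin m) ℝ),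
      ∀ i j, (X * Y) i j = 1 + s i * t j := by
  obtain ⟨r, rfl⟩ := Nat.exists_eq_add_of_le' hr
  refine ⟨Matrix.of fun i => Fin.cons 1 (Fin.cons (s i) 0),
    (Matrix.of fun j => Fin.cons 1 (Fin.cons (t j) 0)).transpose, fun i j => ?_⟩
  simp [Matrix.mul_apply, Fin.sum_univ_succ]

/-- For a fixed exponent, a suitable minor of the Hadamard power is a polynomial in the entries that
is generically nonzero and certifies the rank from below. -/
theorem exists_poly_le_rank_map_pow (n m r d : ℕ) :
    ∃ p : MvPolynomial (Fin n × Fin m) ℝ,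
      Dense {A : {A : Matrix (Fin n) (Fin m) ℝ // A.rank = r} |
        MvPolynomial.eval (fun x => A.1 x.1 x.2) p ≠ 0} ∧
      ∀ A : Matrix (Fin n) (Fin m) ℝ, MvPolynomial.eval (fun x => A x.1 x.2) p ≠ 0 →
        min ((r + d - 1).choose d) (min n m) ≤ (A.map (· ^ d)).rank := by
  set k := min ((r + d - 1).choose d) (min n m) with hk
  have hkn : k ≤ n := by omega
  have hkm : k ≤ m := by omega
  let p : MvPolynomial (Fin n × Fin m) ℝ := (Matrix.of fun i j : Fin k =>
    (MvPolynomial.X (Fin.castLE hkn i, Fin.castLE hkm j) ^ d :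
      MvPolynomial (Fin n × Fin m) ℝ)).det
  have hp : ∀ A : Matrix (Fin n) (Fin m) ℝ, MvPolynomial.eval (fun x => A x.1 x.2) p =
      ((A.map (· ^ d)).submatrix (Fin.castLE hkn) (Fin.castLE hkm)).det := by
    intro A
    rw [RingHom.map_det]
    congr 1
    ext i j
    simp
  refine ⟨p, ?_, fun A hA => le_rank_of_det_submatrix_ne_zero _ _ (hp A ▸ hA)⟩
  let c : ℕ → Fin r → ℝ := fun i a => ((Nat.nth Nat.Prime a : ℕ) : ℝ) ^ i
  refine dense_eval_ne_zero p (Matrix.of fun i a => c i a) (Matrix.of fun a j => c j a) ?_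
  rw [hp]
  exact det_pow_gram_ne_zero (min_le_left _ _)

/-- For `r ≥ 2`, generically the Hadamard powers of large exponent have full rank, uniformly
nearby. -/
theorem dense_eventually_le_rank_map_pow {n m r : ℕ} (hr : 2 ≤ r) :
    Dense {A : {A : Matrix (Fin n) (Fin m) ℝ // A.rank = r} |
      ∃ D : ℕ, ∀ᶠ B in 𝓝 A, ∀ d ≥ D, min n m ≤ (B.1.map (· ^ d)).rank} := by
  set k := min n m with hk
  have hkn : k ≤ n := by omega
  have hkm : k ≤ m := by omega
  let M : Equiv.Perm (Fin k) → MvPolynomial (Fin n × Fin m) ℝ := fun σ =>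
    ∏ i, MvPolynomial.X (Fin.castLE hkn (σ i), Fin.castLE hkm i)
  have hM : ∀ (σ) (A : Matrix (Fin n) (Fin m) ℝ), MvPolynomial.eval (fun x => A x.1 x.2) (M σ) =
      ∏ i, A.submatrix (Fin.castLE hkn) (Fin.castLE hkm) (σ i) i := by
    simp [M]
  obtain ⟨X, Y, hXY⟩ := exists_mul_eq_one_add hr (0 : Fin n → ℝ) (0 : Fin m → ℝ)
  have hd₀ := dense_eval_ne_zero (M 1) X Y (by rw [hM]; simp [hXY])
  have hd₁ := dense_iInter_of_isOpen_finite
    (fun x : {x : Equiv.Perm (Fin k) × Equiv.Perm (Fin k) // x.1 ≠ x.2} =>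
      isOpen_eval_ne_zero (r := r) (M x.1.1 ^ 2 - M x.1.2 ^ 2)) (by
    rintro ⟨⟨σ, τ⟩, hστ⟩
    obtain ⟨i₀, hi₀⟩ : ∃ i, σ i ≠ τ i := by
      by_contra! h
      exact hστ (Equiv.ext h)
    obtain ⟨X, Y, h⟩ := exists_mul_eq_one_add hr (fun i : Fin n => (i : ℝ))
      (fun j : Fin m => if j = Fin.castLE hkm i₀ then 1 else 0)
    refine dense_eval_ne_zero _ X Y ?_
    have hprod : ∀ σ : Equiv.Perm (Fin k), MvPolynomial.eval (fun x => (X * Y) x.1 x.2) (M σ) =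
        1 + (σ i₀ : ℕ) := by
      intro σ
      rw [hM, Finset.prod_eq_single i₀]
      · simp [h]
      · intro j _ hj
        simp [h, hj]
      · simp
    rw [map_sub, map_pow, map_pow, hprod, hprod, sub_ne_zero, Ne,
      sq_eq_sq₀ (by positivity) (by positivity)]
    simpa [Fin.ext_iff] using hi₀)
  refine (hd₀.inter_of_isOpen_left hd₁ (isOpen_eval_ne_zero _)).mono ?_
  rintro A ⟨h₀, h₁⟩
  obtain ⟨D, hD⟩ := eventually_det_map_pow_ne_zero
    (A.1.submatrix (Fin.castLE hkn) (Fin.castLE hkm)) (by simpa [hM] using h₀) (by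
      intro σ τ hστ
      have := Set.mem_iInter.1 h₁ ⟨(σ, τ), hστ⟩
      rwa [Set.mem_ofPred_eq, map_sub, map_pow, map_pow, hM, hM, sub_ne_zero] at this)
  refine ⟨D, ?_⟩
  have hc : Continuous fun B : {A : Matrix (Fin n) (Fin m) ℝ // A.rank = r} =>
      B.1.submatrix (Fin.castLE hkn) (Fin.castLE hkm) :=
    continuous_subtype_val.matrix_submatrix _ _
  filter_upwards [hc.continuousAt.eventually hD] with B hB d hd
  exact le_rank_of_det_submatrix_ne_zero _ _ (hB d hd)

theorem dense_interior_le_rank_map_pow (n m r : ℕ) :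
    Dense (interior {A : {A : Matrix (Fin n) (Fin m) ℝ // A.rank = r} |
      ∀ d : ℕ, 0 < d → min ((r + d - 1).choose d) (min n m) ≤ (A.1.map (· ^ d)).rank}) := by
  rcases lt_or_ge r 2 with hr | hr
  · convert dense_univ
    rw [interior_eq_univ, Set.eq_univ_iff_forall]
    rintro ⟨A, hA⟩ d hd
    obtain rfl | rfl : r = 0 ∨ r = 1 := by omega
    · simp [Nat.choose_eq_zero_of_lt (Nat.sub_lt hd one_pos)]
    · have hA0 : A ≠ 0 := by
        rintro rfl
        simp at hA
      obtain ⟨i, j, hij⟩ : ∃ i j, A i j ≠ 0 := by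
        by_contra! h
        exact hA0 (Matrix.ext h)
      refine (min_le_left _ _).trans ?_
      rw [Nat.add_sub_cancel_left, Nat.choose_self]
      exact le_rank_of_det_submatrix_ne_zero (fun _ => i) (fun _ => j) (by simp [hij])
  choose p hp hpr using exists_poly_le_rank_map_pow n m r
  rw [dense_iff_inter_open]
  intro U hU hUne
  obtain ⟨A, hAU, D, hD⟩ := (dense_eventually_le_rank_map_pow hr).inter_open_nonempty U hU hUne
  obtain ⟨V, hV, hVo, hAV⟩ := eventually_nhds_iff.1 hD
  have hFo := isOpen_iInter_of_finite fun d : Fin D => isOpen_eval_ne_zero (r := r) (p d)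
  obtain ⟨B, ⟨hBU, hBV⟩, hBF⟩ := (dense_iInter_of_isOpen_finite
    (fun d : Fin D => isOpen_eval_ne_zero (r := r) (p d)) fun d => hp d).inter_open_nonempty
      (U ∩ V) (hU.inter hVo) ⟨A, hAU, hAV⟩
  refine ⟨B, hBU, mem_interior.2 ⟨_, ?_, hVo.inter hFo, hBV, hBF⟩⟩
  rintro C ⟨hCV, hCF⟩ d -
  rcases lt_or_ge d D with hd | hd
  · exact hpr d C.1 (Set.mem_iInter.1 hCF ⟨d, hd⟩)
  · exact (min_le_right _ _).trans (hV C hCV d hd)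

/-- For all positive integers `n, m` and all `r ≤ min{n,m}`, there exists an open
and dense subset `𝒜_r` of `M_r = { A ∈ ℝ^{n×m} : rank A = r }` (subspace topology) such that for
every `A ∈ 𝒜_r` and every positive integer `d`,
`rank (A^∘d) = min{ binom(r+d−1, d), n, m }`. -/
theorem generic_rank_hadamard_power (n m r : ℕ) (hn : 0 < n) (hm : 0 < m)
    (hr : r ≤ min n m) :
    ∃ 𝒜 : Set {A : Matrix (Fin n) (Fin m) ℝ // A.rank = r},
      IsOpen 𝒜 ∧ Dense 𝒜 ∧
      ∀ A ∈ 𝒜, ∀ d : ℕ, 0 < d →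
        (Matrix.of fun i j => (A : Matrix (Fin n) (Fin m) ℝ) i j ^ d).rank =
          min (Nat.choose (r + d - 1) d) (min n m) := by
  refine ⟨_, isOpen_interior, dense_interior_le_rank_map_pow n m r, fun A hA d hd => ?_⟩
  exact le_antisymm
    (le_min (rank_map_pow_le A.1 A.2) (le_min (Matrix.rank_le_height _) (Matrix.rank_le_width _)))
    (interior_subset hA d hd)
end

section
/- Let n, m, r be positive integers with 2 ≤ r ≤ min{n, m}. There exists an open and dense subset 𝒜_r of M_r = { A ∈ ℝ^{n×m} : rank A = r } such that: (i) for every A ∈ 𝒜_r and every positive integer d, rank(A^∘d) = min{ binom(r+d−1, d), n, m }; and (ii) for every A ∈ ℝ^{n×m} whose entrywise absolute value |A| = (|a_ij|) lies in 𝒜_r, the set of real exponents d > 0 for which the non-integer Hadamard power |A|^∘d = (|a_ij|^d) has rank strictly less than min{n, m} is finite. -/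
open Finset in
lemma card_piAntidiag_univ (r d : ℕ) :
    #(piAntidiag (univ : Finset (Fin r)) d) = (r + d - 1).choose d := by
  simpa [finsuppAntidiag] using
    card_finsuppAntidiag_nat_eq_choose (s := (univ : Finset (Fin r))) d

lemma Matrix.le_rank_of_submatrix_det_ne_zero {ι κ : Type*} [Fintype ι] [Fintype κ] {N : ℕ}
    {A : Matrix ι κ ℝ} {f : Fin N → ι} {g : Fin N → κ} (h : (A.submatrix f g).det ≠ 0) :
    N ≤ A.rank := by
  have h1 := Matrix.rank_of_isUnit (A.submatrix f g)
    ((Matrix.isUnit_iff_isUnit_det _).2 h.isUnit)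
  rw [Fintype.card_fin] at h1
  exact h1 ▸ A.rank_submatrix_le f g

/-- The multinomial expansion of the powers of an inner product. -/
lemma sum_mul_pow_eq {r : ℕ} (d : ℕ) (u v : Fin r → ℝ) :
    (∑ a, u a * v a) ^ d = ∑ k : Finset.piAntidiag (Finset.univ : Finset (Fin r)) d,
      (Nat.multinomial Finset.univ k.1 : ℝ) * ((∏ a, u a ^ k.1 a) * ∏ a, v a ^ k.1 a) := by
  rw [Finset.sum_pow_eq_sum_piAntidiag, ← Finset.sum_coe_sort]
  simp only [mul_pow, Finset.prod_mul_distrib]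

lemma Matrix.rank_of_mul_pow_le {ι κ : Type*} [Fintype ι] [Fintype κ] {r : ℕ}
    (U : Matrix ι (Fin r) ℝ) (V : Matrix (Fin r) κ ℝ) (d : ℕ) :
    (Matrix.of fun i j => (U * V) i j ^ d).rank ≤ (r + d - 1).choose d := by
  have h : (Matrix.of fun i j => (U * V) i j ^ d) =
      (Matrix.of fun i (k : Finset.piAntidiag (Finset.univ : Finset (Fin r)) d) =>
        (Nat.multinomial Finset.univ k.1 : ℝ) * ∏ a, U i a ^ k.1 a) *
      (Matrix.of fun (k : Finset.piAntidiag (Finset.univ : Finset (Fin r)) d) j =>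
        ∏ a, V a j ^ k.1 a) := by
    ext i j
    simp only [Matrix.of_apply, Matrix.mul_apply, mul_assoc]
    exact sum_mul_pow_eq d (U i) (V · j)
  rw [h, ← card_piAntidiag_univ, ← Fintype.card_coe]
  exact (Matrix.rank_mul_le_left _ _).trans (Matrix.rank_le_card_width _)

lemma Matrix.exists_eq_mul_of_rank_eq {ι : Type*} [Fintype ι] {κ : Type*} [Fintype κ] {r : ℕ}
    {A : Matrix ι κ ℝ} (h : A.rank = r) :
    ∃ (U : Matrix ι (Fin r) ℝ) (V : Matrix (Fin r) κ ℝ), A = U * V := by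
  rw [Matrix.rank_eq_finrank_span_cols] at h
  let b := Module.finBasisOfFinrankEq ℝ _ h
  refine ⟨Matrix.of fun i a => (b a : ι → ℝ) i, Matrix.of fun a j =>
    b.repr ⟨A.col j, Submodule.subset_span ⟨j, rfl⟩⟩ a, ?_⟩
  ext i j
  have := congrArg (fun x : Submodule.span ℝ (Set.range A.col) => (x : ι → ℝ) i)
    (b.sum_repr ⟨A.col j, Submodule.subset_span ⟨j, rfl⟩⟩)
  simp only [Submodule.coe_sum, Submodule.coe_smul, Finset.sum_apply, Pi.smul_apply,
    smul_eq_mul, Matrix.col_apply] at this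
  rw [← this]
  simp [Matrix.mul_apply, mul_comm]

lemma eq_zero_of_sum_mul_monomial_eq_zero {r d : ℕ}
    (c : Finset.piAntidiag (Finset.univ : Finset (Fin r)) d → ℝ)
    (h : ∀ u : Fin r → ℝ, ∑ k, c k * ∏ a, u a ^ k.1 a = 0) : c = 0 := by
  let p : MvPolynomial (Fin r) ℝ :=
    ∑ k, MvPolynomial.monomial (Finsupp.equivFunOnFinite.symm k.1) (c k)
  have hp : p = 0 := by
    refine MvPolynomial.funext fun u => ?_
    simpa [p, MvPolynomial.eval_monomial, Finsupp.prod_fintype] using h u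
  ext k
  have := congrArg (MvPolynomial.coeff (Finsupp.equivFunOnFinite.symm k.1)) hp
  rw [MvPolynomial.coeff_zero, MvPolynomial.coeff_sum, Finset.sum_eq_single k] at this
  · simpa using this
  · intro l _ hl
    rw [MvPolynomial.coeff_monomial, if_neg]
    exact fun h => hl (Subtype.ext (Finsupp.equivFunOnFinite.symm.injective h))
  · simp

lemma exists_linearIndependent_monomial {r d N : ℕ} (hN : N ≤ (r + d - 1).choose d) :
    ∃ w : Fin N → Fin r → ℝ, LinearIndependent ℝ
      (fun i (k : Finset.piAntidiag (Finset.univ : Finset (Fin r)) d) =>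
        ∏ a, w i a ^ k.1 a) := by
  let F : (Fin r → ℝ) → Finset.piAntidiag (Finset.univ : Finset (Fin r)) d → ℝ :=
    fun u k => ∏ a, u a ^ k.1 a
  have htop : Submodule.span ℝ (Set.range F) = ⊤ := by
    by_contra hne
    obtain ⟨φ, hφ, hle⟩ := Submodule.exists_le_ker_of_lt_top _ (lt_top_iff_ne_top.2 hne)
    refine hφ (LinearMap.pi_ext' fun k => LinearMap.ext_ring ?_)
    have := eq_zero_of_sum_mul_monomial_eq_zero
      (fun k => φ fun j => if k = j then 1 else 0) fun u => by
      have h0 : φ (F u) = 0 := hle (Submodule.subset_span ⟨u, rfl⟩)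
      rw [LinearMap.pi_apply_eq_sum_univ] at h0
      simpa only [F, mul_comm, smul_eq_mul] using h0
    have hk : (Pi.single k 1 : _ → ℝ) = fun j => if k = j then 1 else 0 := by
      ext j
      simp [Pi.single_apply, eq_comm]
    simpa [hk] using congrFun this k
  obtain ⟨f, hf, -, hli⟩ := Submodule.exists_fun_fin_finrank_span_eq ℝ (Set.range F)
  choose g hg using hf
  have hcard : N ≤ Module.finrank ℝ (Submodule.span ℝ (Set.range F)) := by
    rw [htop, finrank_top, Module.finrank_fintype_fun_eq_card, Fintype.card_coe,
      card_piAntidiag_univ]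
    exact hN
  refine ⟨fun i => g (Fin.castLE hcard i), ?_⟩
  have hcomp := hli.comp _ (Fin.castLE_injective hcard)
  rwa [← show (fun i => F (g (Fin.castLE hcard i))) = f ∘ Fin.castLE hcard from
    funext fun i => hg _] at hcomp

lemma exists_det_pow_sum_mul_ne_zero {r d N : ℕ} (hN : N ≤ (r + d - 1).choose d) :
    ∃ w : Fin N → Fin r → ℝ,
      (Matrix.of fun i j => (∑ a, w i a * w j a) ^ d).det ≠ 0 := by
  obtain ⟨w, hw⟩ := exists_linearIndependent_monomial hN
  refine ⟨w, fun hdet => ?_⟩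
  obtain ⟨x, hx, hx0⟩ := Matrix.exists_mulVec_eq_zero_iff.2 hdet
  refine hx (funext (Fintype.linearIndependent_iff.1 hw x (funext fun k => ?_)))
  have hsum : ∑ k : Finset.piAntidiag (Finset.univ : Finset (Fin r)) d,
      (Nat.multinomial Finset.univ k.1 : ℝ) * (∑ i, x i * ∏ a, w i a ^ k.1 a) ^ 2 = 0 := by
    have h0 : ∑ i, x i * ∑ j, (∑ a, w i a * w j a) ^ d * x j = 0 := by
      refine Finset.sum_eq_zero fun i _ => ?_
      have := congrFun hx0 i
      simp only [Matrix.mulVec, dotProduct, Matrix.of_apply, Pi.zero_apply] at this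
      rw [this, mul_zero]
    rw [← h0]
    simp only [sum_mul_pow_eq, sq, Finset.mul_sum, Finset.sum_mul]
    rw [Finset.sum_comm]
    refine Finset.sum_congr rfl fun i _ => ?_
    rw [Finset.sum_comm]
    exact Finset.sum_congr rfl fun j _ => Finset.sum_congr rfl fun k _ => by ring
  have := (Finset.sum_eq_zero_iff_of_nonneg fun k _ => by positivity).1 hsum k (Finset.mem_univ k)
  have hpos : (Nat.multinomial Finset.univ k.1 : ℝ) ≠ 0 := by
    exact_mod_cast (Nat.multinomial_pos _ _).ne'
  simpa [hpos] using this

/-- A sum in which one term outweighs all the others together does not vanish. -/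
lemma sum_mul_ne_zero_of_dominant {ι : Type*} [Fintype ι] {s x : ι → ℝ} {i₀ : ι} {ε : ℝ}
    (hs : ∀ i, |s i| = 1) (h0 : x i₀ ≠ 0) (hx : ∀ i, i ≠ i₀ → |x i| ≤ ε * |x i₀|)
    (hε : 0 ≤ ε) (hcard : Fintype.card ι * ε < 1) : ∑ i, s i * x i ≠ 0 := by
  classical
  intro h
  rw [← Finset.add_sum_erase _ _ (Finset.mem_univ i₀)] at h
  have hpos : 0 < |x i₀| := abs_pos.2 h0
  have h1 : |x i₀| ≤ ∑ i ∈ Finset.univ.erase i₀, ε * |x i₀| := by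
    calc |x i₀| = |s i₀ * x i₀| := by rw [abs_mul, hs, one_mul]
      _ = |∑ i ∈ Finset.univ.erase i₀, s i * x i| := by
        rw [eq_neg_of_add_eq_zero_left h, abs_neg]
      _ ≤ ∑ i ∈ Finset.univ.erase i₀, |s i * x i| := Finset.abs_sum_le_sum_abs _ _
      _ ≤ _ := Finset.sum_le_sum fun i hi => by
        rw [abs_mul, hs, one_mul]
        exact hx i (Finset.ne_of_mem_erase hi)
  have h2 : ∑ i ∈ Finset.univ.erase i₀, ε * |x i₀| ≤ ∑ _i : ι, ε * |x i₀| :=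
    Finset.sum_le_sum_of_subset_of_nonneg (Finset.erase_subset _ _) fun _ _ _ => by positivity
  simp only [Finset.sum_const (s := Finset.univ), Finset.card_univ, nsmul_eq_mul,
    ← mul_assoc] at h2
  nlinarith

/-- One of the products in the Leibniz expansion of `det B` exceeds all the others in
absolute value. -/
def HasDominantPerm {k : ℕ} (B : Matrix (Fin k) (Fin k) ℝ) : Prop :=
  ∃ σ : Equiv.Perm (Fin k), ∀ τ, τ ≠ σ → |∏ i, B (τ i) i| < |∏ i, B (σ i) i|

lemma abs_sign_cast {k : ℕ} (σ : Equiv.Perm (Fin k)) :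
    |((Equiv.Perm.sign σ : ℤ) : ℝ)| = 1 := by
  rcases Int.units_eq_one_or (Equiv.Perm.sign σ) with h | h <;> simp [h]

section Dominance

variable {k : ℕ} {B : Matrix (Fin k) (Fin k) ℝ}

lemma prod_ne_zero_of_dominant (hk : 2 ≤ k) {σ : Equiv.Perm (Fin k)} {q : ℝ}
    (hq : ∀ τ, τ ≠ σ → |∏ i, B (τ i) i| < q * |∏ i, B (σ i) i|) :
    ∏ i, B (σ i) i ≠ 0 := by
  have : Nontrivial (Fin k) := Fin.nontrivial_iff_two_le.2 hk
  obtain ⟨τ, hτ⟩ := exists_ne σ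
  intro h
  have := hq τ hτ
  rw [h, abs_zero, mul_zero] at this
  exact absurd this (abs_nonneg _).not_gt

lemma HasDominantPerm.exists_ratio (hB : HasDominantPerm B) :
    ∃ σ : Equiv.Perm (Fin k), ∃ q : ℝ, 0 < q ∧ q < 1 ∧
      ∀ τ, τ ≠ σ → |∏ i, B (τ i) i| < q * |∏ i, B (σ i) i| := by
  obtain ⟨σ, hσ⟩ := hB
  have h1 : ∀ᶠ q : ℝ in nhdsWithin 1 (Set.Iio 1),
      ∀ τ, τ ≠ σ → |∏ i, B (τ i) i| < q * |∏ i, B (σ i) i| := by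
    refine nhdsWithin_le_nhds (Filter.eventually_all.2 fun τ => ?_)
    by_cases h : τ = σ
    · simp [h]
    · have hc : Continuous fun q : ℝ => q * |∏ i, B (σ i) i| := by fun_prop
      filter_upwards [(hc.tendsto 1).eventually_const_lt
        (by rw [one_mul]; exact hσ τ h)] with q hq _ using hq
  have h2 : ∀ᶠ q : ℝ in nhdsWithin 1 (Set.Iio 1), q ∈ Set.Ioo (0 : ℝ) 1 :=
    Ioo_mem_nhdsLT one_pos
  obtain ⟨q, hq, hq'⟩ := (h1.and h2).exists
  exact ⟨σ, q, hq'.1, hq'.2, hq⟩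

lemma exists_card_perm_mul_pow_lt (k : ℕ) {q : ℝ} (h1 : q < 1) :
    ∃ D : ℕ, Fintype.card (Equiv.Perm (Fin k)) * q ^ D < 1 := by
  have hc : (0 : ℝ) < Fintype.card (Equiv.Perm (Fin k)) := by exact_mod_cast Fintype.card_pos
  obtain ⟨D, hD⟩ := exists_pow_lt_of_lt_one (inv_pos.2 hc) h1
  exact ⟨D, by rwa [← one_div, lt_div_iff₀' hc] at hD⟩

lemma det_pow_ne_zero_of_dominant (hk : 2 ≤ k) {σ : Equiv.Perm (Fin k)} {q : ℝ}
    (h0 : 0 < q) (h1 : q < 1)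
    (hq : ∀ τ, τ ≠ σ → |∏ i, B (τ i) i| < q * |∏ i, B (σ i) i|) {D d : ℕ}
    (hD : Fintype.card (Equiv.Perm (Fin k)) * q ^ D < 1) (hd : D ≤ d) :
    (Matrix.of fun i j => B i j ^ d).det ≠ 0 := by
  rw [Matrix.det_apply']
  simp only [Matrix.of_apply, Finset.prod_pow]
  refine sum_mul_ne_zero_of_dominant (i₀ := σ) (ε := q ^ d) abs_sign_cast
    (pow_ne_zero _ (prod_ne_zero_of_dominant hk hq)) (fun τ hτ => ?_) (by positivity) ?_
  · rw [abs_pow, abs_pow, ← mul_pow]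
    exact pow_le_pow_left₀ (abs_nonneg _) (hq τ hτ).le _
  · refine lt_of_le_of_lt ?_ hD
    gcongr ?_ * ?_
    exact pow_le_pow_of_le_one h0.le h1.le hd

lemma det_rpow_ne_zero_of_dominant (hk : 2 ≤ k) (hB : ∀ i j, 0 ≤ B i j)
    {σ : Equiv.Perm (Fin k)} {q : ℝ} (h0 : 0 < q) (h1 : q < 1)
    (hq : ∀ τ, τ ≠ σ → |∏ i, B (τ i) i| < q * |∏ i, B (σ i) i|) {D : ℕ}
    (hD : Fintype.card (Equiv.Perm (Fin k)) * q ^ D < 1) {d : ℝ} (hd : D ≤ d) :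
    (Matrix.of fun i j => B i j ^ d).det ≠ 0 := by
  have hnn : ∀ τ : Equiv.Perm (Fin k), 0 ≤ ∏ i, B (τ i) i :=
    fun τ => Finset.prod_nonneg fun i _ => hB _ _
  have hd0 : 0 ≤ d := (Nat.cast_nonneg D).trans hd
  rw [Matrix.det_apply']
  simp only [Matrix.of_apply, Real.finsetProd_rpow _ _ (fun i _ => hB _ _)]
  have hpos := (hnn σ).lt_of_ne' (prod_ne_zero_of_dominant hk hq)
  refine sum_mul_ne_zero_of_dominant (i₀ := σ) (ε := q ^ d) abs_sign_cast
    (Real.rpow_pos_of_pos hpos d).ne' (fun τ hτ => ?_) (by positivity) ?_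
  · rw [Real.abs_rpow_of_nonneg (hnn _), Real.abs_rpow_of_nonneg (hnn _),
      ← Real.mul_rpow h0.le (abs_nonneg _)]
    exact Real.rpow_le_rpow (abs_nonneg _) (hq τ hτ).le hd0
  · refine lt_of_le_of_lt ?_ hD
    gcongr ?_ * ?_
    rw [← Real.rpow_natCast]
    exact Real.rpow_le_rpow_of_exponent_ge h0 h1.le hd

/-- Domination is stable, and near a dominated matrix all large Hadamard powers are
nonsingular. -/
lemma HasDominantPerm.eventually (hk : 2 ≤ k) (hB : HasDominantPerm B) :
    ∃ D : ℕ, ∀ᶠ C in nhds B, HasDominantPerm C ∧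
      ∀ d, D ≤ d → (Matrix.of fun i j => C i j ^ d).det ≠ 0 := by
  obtain ⟨σ, q, h0, h1, hq⟩ := hB.exists_ratio
  obtain ⟨D, hD⟩ := exists_card_perm_mul_pow_lt k h1
  have hnear : ∀ᶠ C : Matrix (Fin k) (Fin k) ℝ in nhds B,
      ∀ τ, τ ≠ σ → |∏ i, C (τ i) i| < q * |∏ i, C (σ i) i| := by
    refine Filter.eventually_all.2 fun τ => ?_
    by_cases h : τ = σ
    · simp [h]
    · have hc : ∀ ρ : Equiv.Perm (Fin k),
          Continuous fun C : Matrix (Fin k) (Fin k) ℝ => |∏ i, C (ρ i) i| := fun ρ =>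
        (continuous_finsetProd _ fun i _ => continuous_id.matrix_elem _ _).abs
      filter_upwards [(hc τ).continuousAt.eventually_lt
        ((hc σ).const_mul q).continuousAt (hq τ h)] with C hC _ using hC
  refine ⟨D, hnear.mono fun C hC => ⟨⟨σ, fun τ hτ => (hC τ hτ).trans_le ?_⟩, fun d hd =>
    det_pow_ne_zero_of_dominant hk h0 h1 hC hD hd⟩⟩
  exact mul_le_of_le_one_left (abs_nonneg _) h1.le

/-- The zeros of the exponential sum `d ↦ det (b_ij ^ d)` are finitely many. -/
lemma HasDominantPerm.finite_det_rpow_eq_zero (hk : 2 ≤ k) (hB : HasDominantPerm B)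
    (hnonneg : ∀ i j, 0 ≤ B i j) :
    {d : ℝ | 0 < d ∧ (Matrix.of fun i j => B i j ^ d).det = 0}.Finite := by
  obtain ⟨σ, q, h0, h1, hq⟩ := hB.exists_ratio
  obtain ⟨D, hD⟩ := exists_card_perm_mul_pow_lt k h1
  have hne := fun {d : ℝ} => det_rpow_ne_zero_of_dominant (d := d) hk hnonneg h0 h1 hq hD
  let g : ℝ → ℝ := fun d => ∑ τ : Equiv.Perm (Fin k), ((Equiv.Perm.sign τ : ℤ) : ℝ) *
    if ∏ i, B (τ i) i = 0 then 0 else Real.exp (Real.log (∏ i, B (τ i) i) * d)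
  have hg : ∀ d, 0 < d → (Matrix.of fun i j => B i j ^ d).det = g d := by
    intro d hd
    rw [Matrix.det_apply']
    simp only [Matrix.of_apply, Real.finsetProd_rpow _ _ (fun i _ => hnonneg _ _)]
    refine Finset.sum_congr rfl fun τ _ => ?_
    congr 1
    split_ifs with h
    · rw [h, Real.zero_rpow hd.ne']
    · rw [Real.rpow_def_of_pos]
      exact (Finset.prod_nonneg fun i _ => hnonneg _ _).lt_of_ne' h
  have hana : AnalyticOnNhd ℝ g Set.univ := by
    intro x _
    refine Finset.analyticAt_fun_sum _ fun τ _ => analyticAt_const.mul ?_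
    split_ifs
    · exact analyticAt_const
    · exact (analyticAt_const.mul analyticAt_id).rexp
  have hD1 : g (D + 1) ≠ 0 := by
    rw [← hg _ (by positivity)]
    exact hne (by linarith)
  have hfin := isCompact_Icc.finite_sdiff_of_mem_codiscreteWithin
    (Filter.codiscreteWithin_mono (Set.subset_univ (Set.Icc (0 : ℝ) D))
      (hana.preimage_zero_mem_codiscrete hD1))
  refine hfin.subset fun d ⟨hd, hdet⟩ => ⟨⟨hd.le, ?_⟩, ?_⟩
  · by_contra hlt
    exact hne (not_le.1 hlt).le hdet
  · simpa [← hg d hd] using hdet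

end Dominance

section LeadingMinor

variable {n m : ℕ}

/-- The top left `N × N` block. -/
def leadingBlock (A : Matrix (Fin n) (Fin m) ℝ) {N : ℕ} (h : N ≤ min n m) :
    Matrix (Fin N) (Fin N) ℝ :=
  A.submatrix (Fin.castLE (h.trans (min_le_left n m))) (Fin.castLE (h.trans (min_le_right n m)))

lemma continuous_leadingBlock {N : ℕ} (h : N ≤ min n m) :
    Continuous fun A : Matrix (Fin n) (Fin m) ℝ => leadingBlock A h :=
  continuous_id.matrix_submatrix _ _

variable (n m) in
/-- Matrices whose leading square block has a dominant Leibniz product and whose Hadamard powers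
have a nonvanishing leading minor of the largest order that rank `r` allows. -/
def genericMatrices (r : ℕ) : Set (Matrix (Fin n) (Fin m) ℝ) :=
  {A | HasDominantPerm (leadingBlock A le_rfl) ∧ ∀ d, 0 < d →
    (leadingBlock (Matrix.of fun i j => A i j ^ d)
      (min_le_right ((r + d - 1).choose d) (min n m))).det ≠ 0}

lemma le_choose_of_two_le {r : ℕ} (hr : 2 ≤ r) (d : ℕ) : d ≤ (r + d - 1).choose d := by
  calc d ≤ (d + 1).choose d := by rw [Nat.choose_succ_self_right]; omega
    _ ≤ _ := Nat.choose_le_choose d (by omega)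

lemma isOpen_genericMatrices {r : ℕ} (hr : 2 ≤ r) (hk : 2 ≤ min n m) :
    IsOpen (genericMatrices n m r) := by
  refine isOpen_iff_mem_nhds.2 fun A ⟨hdom, hA⟩ => ?_
  obtain ⟨D, hD⟩ := hdom.eventually hk
  have hsmall : ∀ᶠ C in nhds A, ∀ d ∈ Finset.range (max D (min n m)), 0 < d →
      (leadingBlock (Matrix.of fun i j => C i j ^ d)
        (min_le_right ((r + d - 1).choose d) (min n m))).det ≠ 0 := by
    refine (Filter.eventually_all_finset _).2 fun d _ => ?_
    by_cases hd : 0 < d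
    · have hc : Continuous fun C : Matrix (Fin n) (Fin m) ℝ =>
          (leadingBlock (Matrix.of fun i j => C i j ^ d)
            (min_le_right ((r + d - 1).choose d) (min n m))).det :=
        ((continuous_leadingBlock (min_le_right _ _)).comp (continuous_matrix fun i j =>
          (continuous_id.matrix_elem i j).pow d)).matrix_det
      filter_upwards [hc.continuousAt.eventually_ne (hA d hd)] with C hC _ using hC
    · simp [hd]
  filter_upwards [(continuous_leadingBlock le_rfl).continuousAt.eventually hD, hsmall]
    with C hC hC'
  refine ⟨hC.1, fun d hd => ?_⟩
  by_cases hlt : d < max D (min n m)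
  · exact hC' d (Finset.mem_range.2 hlt) hd
  · have hN : min ((r + d - 1).choose d) (min n m) = min n m :=
      min_eq_right (((le_max_right _ _).trans (not_lt.1 hlt)).trans (le_choose_of_two_le hr d))
    have key : ∀ N (h : N ≤ min n m), N = min n m →
        (leadingBlock (Matrix.of fun i j => C i j ^ d) h).det ≠ 0 := by
      rintro _ h rfl
      exact hC.2 d ((le_max_left _ _).trans (not_lt.1 hlt))
    exact key _ _ hN

lemma rank_pow_of_mem_genericMatrices {r : ℕ} {U : Matrix (Fin n) (Fin r) ℝ}
    {V : Matrix (Fin r) (Fin m) ℝ} (h : U * V ∈ genericMatrices n m r) {d : ℕ} (hd : 0 < d) :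
    (Matrix.of fun i j => (U * V) i j ^ d).rank =
      min ((r + d - 1).choose d) (min n m) :=
  le_antisymm (le_min (Matrix.rank_of_mul_pow_le U V d)
    (le_min (Matrix.rank_le_height _) (Matrix.rank_le_width _)))
    (Matrix.le_rank_of_submatrix_det_ne_zero (h.2 d hd))

end LeadingMinor

lemma AnalyticOnNhd.dense_ne_zero {E : Type*} [NormedAddCommGroup E] [NormedSpace ℝ E]
    {f : E → ℝ} (hf : AnalyticOnNhd ℝ f Set.univ) {w : E} (hw : f w ≠ 0) :
    Dense {x | f x ≠ 0} := by
  change Dense {x | f x = 0}ᶜ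
  rw [← interior_eq_empty_iff_dense_compl, Set.eq_empty_iff_forall_notMem]
  intro x hx
  have h0 : f = fun _ => 0 :=
    hf.eq_of_eventuallyEq (z₀ := x) (fun _ _ => analyticAt_const) (mem_interior_iff_mem_nhds.1 hx)
  exact hw (congrFun h0 w)

lemma dense_forall_ne_zero {E ι : Type*} [NormedAddCommGroup E] [NormedSpace ℝ E]
    [CompleteSpace E] [Countable ι] {f : ι → E → ℝ} (hf : ∀ i, AnalyticOnNhd ℝ (f i) Set.univ)
    (hw : ∀ i, ∃ w, f i w ≠ 0) : Dense {x | ∀ i, f i x ≠ 0} := by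
  rw [Set.ofPred_forall]
  refine dense_iInter_of_isOpen (fun i => ?_) fun i => ?_
  · exact isOpen_ne_fun (continuousOn_univ.1 (hf i).continuousOn) continuous_const
  · obtain ⟨w, hw⟩ := hw i
    exact (hf i).dense_ne_zero hw

section Factorization

variable {n m r : ℕ}

/-- The product map parametrizing the matrices of rank at most `r`. -/
def factorMul (x : (Fin n → Fin r → ℝ) × (Fin r → Fin m → ℝ)) : Matrix (Fin n) (Fin m) ℝ :=
  Matrix.of x.1 * Matrix.of x.2

lemma factorMul_apply (x : (Fin n → Fin r → ℝ) × (Fin r → Fin m → ℝ)) (i : Fin n) (j : Fin m) :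
    factorMul x i j = ∑ a, x.1 i a * x.2 a j := rfl

lemma analyticAt_factorMul (i : Fin n) (j : Fin m)
    (x : (Fin n → Fin r → ℝ) × (Fin r → Fin m → ℝ)) :
    AnalyticAt ℝ (fun x : (Fin n → Fin r → ℝ) × (Fin r → Fin m → ℝ) => factorMul x i j) x := by
  simp only [factorMul_apply]
  refine Finset.analyticAt_fun_sum _ fun a _ => ?_
  exact ((((ContinuousLinearMap.proj (R := ℝ) a).comp
      (ContinuousLinearMap.proj (φ := fun _ : Fin n => Fin r → ℝ) i)).comp
      (ContinuousLinearMap.fst ℝ _ (Fin r → Fin m → ℝ))).analyticAt x).mul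
    ((((ContinuousLinearMap.proj (R := ℝ) j).comp
      (ContinuousLinearMap.proj (φ := fun _ : Fin r => Fin m → ℝ) a)).comp
      (ContinuousLinearMap.snd ℝ (Fin n → Fin r → ℝ) _)).analyticAt x)

lemma continuous_factorMul :
    Continuous (factorMul : (Fin n → Fin r → ℝ) × (Fin r → Fin m → ℝ) → _) :=
  continuous_matrix fun i j => continuous_iff_continuousAt.2 fun x =>
    (analyticAt_factorMul i j x).continuousAt

lemma exists_leadingBlock_pow_det_ne_zero (d : ℕ) :
    ∃ x : (Fin n → Fin r → ℝ) × (Fin r → Fin m → ℝ),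
      (leadingBlock (Matrix.of fun i j => factorMul x i j ^ d)
        (min_le_right ((r + d - 1).choose d) (min n m))).det ≠ 0 := by
  obtain ⟨w, hw⟩ := exists_det_pow_sum_mul_ne_zero
    (min_le_left ((r + d - 1).choose d) (min n m))
  refine ⟨⟨fun i a => if h : (i : ℕ) < _ then w ⟨i, h⟩ a else 0,
    fun a j => if h : (j : ℕ) < _ then w ⟨j, h⟩ a else 0⟩, ?_⟩
  convert hw using 2
  ext i j
  simp only [leadingBlock, Matrix.submatrix_apply, Matrix.of_apply, factorMul_apply,
    Fin.val_castLE, Fin.is_lt, dite_true, Fin.eta]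

lemma exists_sq_prod_ne (hr : 2 ≤ r) {σ τ : Equiv.Perm (Fin (min n m))} (h : σ ≠ τ) :
    ∃ x : (Fin n → Fin r → ℝ) × (Fin r → Fin m → ℝ),
      (∏ i, leadingBlock (factorMul x) le_rfl (σ i) i) ^ 2 -
        (∏ i, leadingBlock (factorMul x) le_rfl (τ i) i) ^ 2 ≠ 0 := by
  obtain ⟨i₀, hi₀⟩ : ∃ i, σ i ≠ τ i := by
    by_contra! hall
    exact h (Equiv.ext hall)
  obtain ⟨s, rfl⟩ := Nat.exists_eq_add_of_le' hr
  let x : (Fin n → Fin (s + 2) → ℝ) × (Fin (s + 2) → Fin m → ℝ) :=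
    ⟨fun i a => if a = 0 then 1 else if a = 1 ∧ (i : ℕ) = σ i₀ then 1 else 0,
      fun a j => if a = 0 then 1 else if a = 1 ∧ (j : ℕ) = i₀ then 1 else 0⟩
  have hx : ∀ i j, leadingBlock (factorMul x) le_rfl i j =
      if i = σ i₀ ∧ j = i₀ then 2 else 1 := by
    intro i j
    have h01 : (0 : Fin (s + 2)) ≠ 1 := by simp
    rw [leadingBlock, Matrix.submatrix_apply, factorMul_apply,
      Finset.sum_eq_add_of_mem 0 1 (Finset.mem_univ _) (Finset.mem_univ _) h01
        fun a _ ha => by simp [x, ha.1, ha.2]]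
    simp only [x, Fin.val_castLE, Fin.val_inj]
    by_cases h1 : i = σ i₀ <;> by_cases h2 : j = i₀ <;> norm_num [h1, h2, h01.symm]
  refine ⟨x, ?_⟩
  have hσ : ∏ i, leadingBlock (factorMul x) le_rfl (σ i) i = 2 := by
    rw [Finset.prod_eq_single i₀ (fun i _ hi => by simp [hx, hi]) (by simp)]
    simp [hx]
  have hτ : ∏ i, leadingBlock (factorMul x) le_rfl (τ i) i = 1 := by
    refine Finset.prod_eq_one fun i _ => ?_
    rw [hx, if_neg]
    rintro ⟨h1, rfl⟩
    exact hi₀ h1.symm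
  rw [hσ, hτ]
  norm_num

lemma hasDominantPerm_of_sq_ne {k : ℕ} {B : Matrix (Fin k) (Fin k) ℝ}
    (h : ∀ σ τ : Equiv.Perm (Fin k), σ ≠ τ →
      (∏ i, B (σ i) i) ^ 2 - (∏ i, B (τ i) i) ^ 2 ≠ 0) : HasDominantPerm B := by
  obtain ⟨σ, hσ⟩ := Finite.exists_max fun τ : Equiv.Perm (Fin k) => |∏ i, B (τ i) i|
  refine ⟨σ, fun τ hτ => lt_of_le_of_ne (hσ τ) fun heq => h τ σ hτ ?_⟩
  rw [sub_eq_zero, ← sq_abs, heq, sq_abs]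

lemma dense_factorMul_mem_genericMatrices (hr : 2 ≤ r) :
    Dense {x : (Fin n → Fin r → ℝ) × (Fin r → Fin m → ℝ) |
      factorMul x ∈ genericMatrices n m r} := by
  let f : ℕ ⊕ {p : Equiv.Perm (Fin (min n m)) × Equiv.Perm (Fin (min n m)) // p.1 ≠ p.2} →
      (Fin n → Fin r → ℝ) × (Fin r → Fin m → ℝ) → ℝ :=
    Sum.elim
      (fun d x => (leadingBlock (Matrix.of fun i j => factorMul x i j ^ d)
        (min_le_right ((r + d - 1).choose d) (min n m))).det)
      (fun p x => (∏ i, leadingBlock (factorMul x) le_rfl (p.1.1 i) i) ^ 2 -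
        (∏ i, leadingBlock (factorMul x) le_rfl (p.1.2 i) i) ^ 2)
  have hf : ∀ i, AnalyticOnNhd ℝ (f i) Set.univ := by
    rintro (d | p) x -
    · simp only [f, Sum.elim_inl, Matrix.det_apply']
      exact Finset.analyticAt_fun_sum _ fun σ _ => analyticAt_const.mul
        (Finset.analyticAt_fun_prod _ fun i _ => (analyticAt_factorMul _ _ x).pow d)
    · exact ((Finset.analyticAt_fun_prod _ fun i _ => analyticAt_factorMul _ _ x).pow 2).sub
        ((Finset.analyticAt_fun_prod _ fun i _ => analyticAt_factorMul _ _ x).pow 2)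
  have hw : ∀ i, ∃ w, f i w ≠ 0 := by
    rintro (d | p)
    · exact exists_leadingBlock_pow_det_ne_zero d
    · exact exists_sq_prod_ne hr p.2
  refine (dense_forall_ne_zero hf hw).mono fun x (hx : ∀ i, f i x ≠ 0) =>
    ⟨?_, fun d _ => hx (Sum.inl d)⟩
  exact hasDominantPerm_of_sq_ne fun σ τ h => hx (Sum.inr ⟨(σ, τ), h⟩)

end Factorization

/-- Let `2 ≤ r ≤ min{n,m}`. There is an open dense subset `𝒜_r` of
`M_r = { A ∈ ℝ^{n×m} : rank A = r }` such that (i) for every `A ∈ 𝒜_r` and positive integer `d`,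
`rank (A^∘d) = min{ binom(r+d−1, d), n, m }`; and (ii) for every `A ∈ ℝ^{n×m}` whose entrywise
absolute value `|A|` lies in `𝒜_r`, the set of real exponents `d > 0` for which the non-integer
Hadamard power `|A|^∘d = (|a_ij|^d)` has rank strictly less than `min{n,m}` is finite. -/
theorem generic_rank_noninteger_hadamard_power (n m r : ℕ) (hn : 0 < n) (hm : 0 < m)
    (hr2 : 2 ≤ r) (hr : r ≤ min n m) :
    ∃ 𝒜 : Set {A : Matrix (Fin n) (Fin m) ℝ // A.rank = r},
      IsOpen 𝒜 ∧ Dense 𝒜 ∧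
      (∀ A ∈ 𝒜, ∀ d : ℕ, 0 < d →
        (Matrix.of fun i j => (A : Matrix (Fin n) (Fin m) ℝ) i j ^ d).rank =
          min (Nat.choose (r + d - 1) d) (min n m)) ∧
      (∀ A : Matrix (Fin n) (Fin m) ℝ,
        ∀ habs : (Matrix.of fun i j => |A i j|).rank = r,
        (⟨Matrix.of fun i j => |A i j|, habs⟩ :
            {A : Matrix (Fin n) (Fin m) ℝ // A.rank = r}) ∈ 𝒜 →
        Set.Finite {d : ℝ | 0 < d ∧
          (Matrix.of fun i j => |A i j| ^ d).rank < min n m}) := by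
  have hk : 2 ≤ min n m := hr2.trans hr
  refine ⟨Subtype.val ⁻¹' genericMatrices n m r,
    (isOpen_genericMatrices hr2 hk).preimage continuous_subtype_val, ?_, ?_, ?_⟩
  · rw [dense_iff_inter_open]
    rintro _ ⟨O, hO, rfl⟩ ⟨⟨A, hA⟩, hAO⟩
    obtain ⟨U, V, rfl⟩ := Matrix.exists_eq_mul_of_rank_eq hA
    obtain ⟨x, hxO, hx⟩ := (dense_factorMul_mem_genericMatrices hr2).inter_open_nonempty _
      (hO.preimage continuous_factorMul) ⟨(U, V), hAO⟩
    have hrank := rank_pow_of_mem_genericMatrices hx one_pos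
    simp only [pow_one, Nat.add_sub_cancel, Nat.choose_one_right, min_eq_left hr] at hrank
    exact ⟨⟨factorMul x, hrank⟩, hxO, hx⟩
  · rintro ⟨A, hA⟩ hgen d hd
    obtain ⟨U, V, rfl⟩ := Matrix.exists_eq_mul_of_rank_eq hA
    exact rank_pow_of_mem_genericMatrices hgen hd
  · intro A _ hgen
    refine (hgen.1.finite_det_rpow_eq_zero hk fun _ _ => abs_nonneg _).subset ?_
    rintro d ⟨hd, hlt⟩
    refine ⟨hd, ?_⟩
    by_contra hdet
    exact hlt.not_ge (Matrix.le_rank_of_submatrix_det_ne_zero hdet)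
end
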